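/- arXiv:1509.05494 — 2 statements merged into one kernel-verified Lean document; each statement's English description precedes it below -/
import Mathlib

section
/- Let Δ ≥ 2 be an integer and λ > 0 a real with λ·(Δ−2)^Δ < (Δ−1)^{Δ−1}. Let d < Δ and w₁,…,w_d be positive integers, and let f(x) = λ ∏_{i=1}^d ( 1 − ∏_{j=1}^{w_i} x_{ij}/(1+x_{ij}) ) be a function of the (Σ_i w_i) variables x_{ij}. Let Φ(x) = 1/√(x(1+x)). Let c > 0 satisfy c < min{ (log(1+λ) − log λ)/(2+4λ), ((2λ+1)/2)·log((1+λ)/λ) − 1 }. Then there exists a constant α < 1 depending only on λ and d (not on the w_i) such that Σ_{a=1}^d w_a^c Σ_{b=1}^{w_a} (Φ(f(x))/Φ(x_{ab})) · |∂f/∂x_{ab}(x)| ≤ α for every x = (x_{ij})_{i∈[d], j∈[w_i]} with each x_{ij} ∈ [0, λ]. -/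
/-- The hardcore recursion function
    f(x) = λ ∏_{i=1}^d (1 − ∏_{j=1}^{w_i} x_{ij}/(1+x_{ij})). -/
noncomputable def hardcoreF (lam : ℝ) {d : ℕ} (w : Fin d → ℕ) (x : Fin d → ℕ → ℝ) : ℝ :=
  lam * ∏ i : Fin d, (1 - ∏ j ∈ Finset.range (w i), x i j / (1 + x i j))

/-- The partial derivative ∂f/∂x_{ab} of the hardcore recursion at the point x. -/
noncomputable def hardcorePD (lam : ℝ) {d : ℕ} (w : Fin d → ℕ) (x : Fin d → ℕ → ℝ)
    (a : Fin d) (b : ℕ) : ℝ :=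
  deriv (fun t => hardcoreF lam w (Function.update x a (Function.update (x a) b t))) (x a b)

lemma hc_cosh_pow (s c : ℝ) (hs : 0 < s) (h : c * Real.cosh s ≤ s * Real.sinh s) (w : ℝ) (hw : 1 ≤ w) :
    w ^ c * Real.cosh s ≤ Real.cosh (w * s) := by
  have hder : ∀ x : ℝ, 0 < x → HasDerivAt (fun w : ℝ => Real.log (Real.cosh (w * s)) - c * Real.log w)
      ((Real.sinh (x * s) * s) / Real.cosh (x * s) - c * x⁻¹) x := by
    intro x hx
    have h1 : HasDerivAt (fun w : ℝ => w * s) s x := by simpa using (hasDerivAt_id x).mul_const s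
    exact (h1.cosh.log (Real.cosh_pos _).ne').sub ((Real.hasDerivAt_log hx.ne').const_mul c)
  have hmono : MonotoneOn (fun w : ℝ => Real.log (Real.cosh (w * s)) - c * Real.log w) (Set.Ici 1) := by
    apply monotoneOn_of_deriv_nonneg (convex_Ici 1)
    · intro x hx
      exact (hder x (lt_of_lt_of_le one_pos hx)).continuousAt.continuousWithinAt
    · intro x hx
      rw [interior_Ici] at hx
      exact (hder x (lt_trans one_pos hx)).differentiableAt.differentiableWithinAt
    · intro x hx
      rw [interior_Ici] at hx
      have hx1 : 1 < x := hx
      have hx0 : 0 < x := by linarith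
      rw [(hder x hx0).deriv, sub_nonneg, ← div_eq_mul_inv, div_le_div_iff₀ hx0 (Real.cosh_pos _)]
      -- c cosh(xs) ≤ sinh(xs) s x
      have h2 : 0 ≤ Real.sinh (x * s - s) := Real.sinh_nonneg_iff.2 (by nlinarith)
      rw [Real.sinh_sub] at h2
      have hC := Real.cosh_pos s
      have hCx := Real.cosh_pos (x * s)
      have hS : 0 < Real.sinh (x * s) := Real.sinh_pos_iff.2 (by positivity)
      have h3 : c * Real.cosh (x * s) * Real.cosh s ≤ Real.sinh (x * s) * s * x * Real.cosh s := by
        calc c * Real.cosh (x * s) * Real.cosh s = (c * Real.cosh s) * Real.cosh (x * s) := by ring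
          _ ≤ (s * Real.sinh s) * Real.cosh (x * s) := by gcongr
          _ ≤ s * (Real.sinh (x * s) * Real.cosh s) := by nlinarith
          _ ≤ s * (Real.sinh (x * s) * Real.cosh s) * x := by
              apply le_mul_of_one_le_right (by positivity) hx1.le
          _ = _ := by ring
      exact le_of_mul_le_mul_right h3 hC
  have h4 := hmono (Set.mem_Ici.2 le_rfl) (Set.mem_Ici.2 hw) hw
  simp only [one_mul, Real.log_one, mul_zero, sub_zero] at h4
  have hw0 : 0 < w := by linarith
  rw [← Real.log_le_log_iff (by have := Real.cosh_pos s; positivity) (Real.cosh_pos _),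
    Real.log_mul (by positivity) (Real.cosh_pos _).ne', Real.log_rpow hw0]
  linarith

lemma hc_coth (s : ℝ) (hs : 0 < s) (x : ℝ) (hx : s ≤ x) :
    s * Real.cosh s * Real.sinh x ≤ x * Real.cosh x * Real.sinh s := by
  have hder : ∀ x : ℝ, 0 < x → HasDerivAt (fun x : ℝ => x * Real.cosh x / Real.sinh x)
      (((1 * Real.cosh x + x * Real.sinh x) * Real.sinh x - x * Real.cosh x * Real.cosh x) / Real.sinh x ^ 2) x := by
    intro x hx
    exact ((hasDerivAt_id x).mul (Real.hasDerivAt_cosh x)).div (Real.hasDerivAt_sinh x)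
      (Real.sinh_pos_iff.2 hx).ne'
  have hmono : MonotoneOn (fun x : ℝ => x * Real.cosh x / Real.sinh x) (Set.Ici s) := by
    apply monotoneOn_of_deriv_nonneg (convex_Ici s)
    · intro x hx
      exact (hder x (lt_of_lt_of_le hs hx)).continuousAt.continuousWithinAt
    · intro x hx
      rw [interior_Ici] at hx
      exact (hder x (lt_trans hs hx)).differentiableAt.differentiableWithinAt
    · intro x hx
      rw [interior_Ici] at hx
      have hx0 : 0 < x := lt_trans hs hx
      rw [(hder x hx0).deriv]
      apply div_nonneg _ (sq_nonneg _)
      have h1 := Real.self_le_sinh_iff.2 hx0.le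
      have h2 := Real.one_le_cosh x
      have h3 := Real.cosh_sq x
      nlinarith
  have h4 := hmono (Set.mem_Ici.2 le_rfl) (Set.mem_Ici.2 hx) hx
  simp only at h4
  rwa [div_le_div_iff₀ (Real.sinh_pos_iff.2 hs) (Real.sinh_pos_iff.2 (hs.trans_le hx))] at h4

lemma hc_sinh_pow (s c : ℝ) (hs : 0 < s) (h : (1 + c) * Real.sinh s ≤ s * Real.cosh s) (w : ℝ) (hw : 1 ≤ w) :
    w ^ (1 + c) * Real.sinh s ≤ Real.sinh (w * s) := by
  have hder : ∀ x : ℝ, 0 < x → HasDerivAt (fun w : ℝ => Real.log (Real.sinh (w * s)) - (1 + c) * Real.log w)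
      ((Real.cosh (x * s) * s) / Real.sinh (x * s) - (1 + c) * x⁻¹) x := by
    intro x hx
    have h1 : HasDerivAt (fun w : ℝ => w * s) s x := by simpa using (hasDerivAt_id x).mul_const s
    exact (h1.sinh.log (Real.sinh_pos_iff.2 (by positivity)).ne').sub
      ((Real.hasDerivAt_log hx.ne').const_mul (1 + c))
  have hmono : MonotoneOn (fun w : ℝ => Real.log (Real.sinh (w * s)) - (1 + c) * Real.log w) (Set.Ici 1) := by
    apply monotoneOn_of_deriv_nonneg (convex_Ici 1)
    · intro x hx
      exact (hder x (lt_of_lt_of_le one_pos hx)).continuousAt.continuousWithinAt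
    · intro x hx
      rw [interior_Ici] at hx
      exact (hder x (lt_trans one_pos hx)).differentiableAt.differentiableWithinAt
    · intro x hx
      rw [interior_Ici] at hx
      have hx1 : 1 < x := hx
      have hx0 : 0 < x := by linarith
      have hS : 0 < Real.sinh (x * s) := Real.sinh_pos_iff.2 (by positivity)
      have hS1 : 0 < Real.sinh s := Real.sinh_pos_iff.2 (by positivity)
      rw [(hder x hx0).deriv, sub_nonneg, ← div_eq_mul_inv, div_le_div_iff₀ hx0 hS]
      have h2 := hc_coth s hs (x * s) (by nlinarith)
      have h3 : (1 + c) * Real.sinh (x * s) * Real.sinh s ≤ Real.cosh (x * s) * s * x * Real.sinh s := by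
        calc (1 + c) * Real.sinh (x * s) * Real.sinh s = ((1 + c) * Real.sinh s) * Real.sinh (x * s) := by ring
          _ ≤ (s * Real.cosh s) * Real.sinh (x * s) := by gcongr
          _ ≤ _ := h2
          _ = _ := by ring
      exact le_of_mul_le_mul_right h3 hS1
  have h4 := hmono (Set.mem_Ici.2 le_rfl) (Set.mem_Ici.2 hw) hw
  simp only [one_mul, Real.log_one, mul_zero, sub_zero] at h4
  have hw0 : 0 < w := by linarith
  have hS1 : 0 < Real.sinh s := Real.sinh_pos_iff.2 (by positivity)
  rw [← Real.log_le_log_iff (by positivity) (Real.sinh_pos_iff.2 (by positivity)),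
    Real.log_mul (by positivity) hS1.ne', Real.log_rpow hw0]
  linarith

lemma hc_sinh_super (n : ℕ) (v : ℕ → ℝ) (hv : ∀ j < n, 0 ≤ v j) :
    ∑ j ∈ Finset.range n, Real.sinh (v j) ≤ Real.sinh (∑ j ∈ Finset.range n, v j) := by
  induction n with
  | zero => simp
  | succ n ih =>
    rw [Finset.sum_range_succ, Finset.sum_range_succ, Real.sinh_add]
    have h1 := ih (fun j hj => hv j (by omega))
    have h2 : 0 ≤ ∑ j ∈ Finset.range n, v j :=
      Finset.sum_nonneg (fun j hj => hv j (by have := Finset.mem_range.1 hj; omega))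
    have h3 := Real.sinh_nonneg_iff.2 h2
    have h4 := Real.sinh_nonneg_iff.2 (hv n (by omega))
    have h5 := Real.one_le_cosh (v n)
    have h6 := Real.one_le_cosh (∑ j ∈ Finset.range n, v j)
    nlinarith

lemma hc_sinh_main (s c : ℝ) (hs : 0 < s) (h1 : c * Real.cosh s ≤ s * Real.sinh s)
    (h2 : (1 + c) * Real.sinh s ≤ s * Real.cosh s) (n : ℕ) (hn : 0 < n) (u : ℕ → ℝ)
    (hu : ∀ j < n, s ≤ u j) :
    (n : ℝ) ^ c * ∑ j ∈ Finset.range n, Real.sinh (u j) ≤ Real.sinh (∑ j ∈ Finset.range n, u j) := by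
  have hn1 : (1 : ℝ) ≤ n := by exact_mod_cast hn
  have hn0 : (0 : ℝ) < n := by linarith
  have hC := hc_cosh_pow s c hs h1 n hn1
  have hS := hc_sinh_pow s c hs h2 n hn1
  set V := ∑ j ∈ Finset.range n, (u j - s) with hV
  have hsum : ∑ j ∈ Finset.range n, u j = n * s + V := by
    simp [hV, Finset.sum_sub_distrib]
  have hv : ∀ j < n, 0 ≤ u j - s := fun j hj => sub_nonneg.2 (hu j hj)
  have hV0 : 0 ≤ V := Finset.sum_nonneg (fun j hj => hv j (Finset.mem_range.1 hj))
  have e1 : ∑ j ∈ Finset.range n, Real.sinh (u j)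
      = Real.sinh s * ∑ j ∈ Finset.range n, Real.cosh (u j - s)
        + Real.cosh s * ∑ j ∈ Finset.range n, Real.sinh (u j - s) := by
    rw [Finset.mul_sum, Finset.mul_sum, ← Finset.sum_add_distrib]
    refine Finset.sum_congr rfl (fun j _ => ?_)
    rw [← Real.sinh_add]; congr 1; ring
  have e2 : ∑ j ∈ Finset.range n, Real.cosh (u j - s) ≤ n * Real.cosh V := by
    have : ∑ j ∈ Finset.range n, Real.cosh (u j - s) ≤ ∑ j ∈ Finset.range n, Real.cosh V := by
      refine Finset.sum_le_sum (fun j hj => ?_)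
      rw [Real.cosh_le_cosh, abs_of_nonneg (hv j (Finset.mem_range.1 hj)), abs_of_nonneg hV0]
      exact Finset.single_le_sum (f := fun j => u j - s)
        (fun i hi => hv i (Finset.mem_range.1 hi)) hj
    simpa using this
  have e3 := hc_sinh_super n (fun j => u j - s) hv
  have hs0 : 0 < Real.sinh s := Real.sinh_pos_iff.2 hs
  have hc0 := Real.cosh_pos s
  have hp : 0 < (n : ℝ) ^ c := by positivity
  have hVs : 0 ≤ Real.sinh V := Real.sinh_nonneg_iff.2 hV0
  have hVc := Real.cosh_pos V
  rw [hsum, e1, Real.sinh_add]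
  rw [Real.rpow_add hn0, Real.rpow_one] at hS
  calc _ ≤ (n : ℝ) ^ c * (Real.sinh s * (n * Real.cosh V) + Real.cosh s * Real.sinh V) := by gcongr
    _ = (n * (n : ℝ) ^ c * Real.sinh s) * Real.cosh V + ((n : ℝ) ^ c * Real.cosh s) * Real.sinh V := by ring
    _ ≤ _ := by gcongr

lemma hc_sinh_y (y : ℝ) (hy : 0 < y) : (1 - y) / √y = 2 * Real.sinh (-(Real.log y) / 2) := by
  have h : Real.exp (-(-(Real.log y) / 2)) = √y := by
    rw [Real.sqrt_eq_rpow, Real.rpow_def_of_pos hy]; congr 1; ring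
  have h' : Real.exp (-(Real.log y) / 2) = (√y)⁻¹ := by
    rw [← h, ← Real.exp_neg, neg_neg]
  have hq : 0 < √y := Real.sqrt_pos.2 hy
  have := Real.sq_sqrt hy.le
  rw [Real.sinh_eq, h, h']
  field_simp
  linarith

/-- per-edge bound -/
lemma hc_edge (lam c : ℝ) (hlam : 0 < lam)
    (hc : c < min ((Real.log (1 + lam) - Real.log lam) / (2 + 4 * lam))
        ((2 * lam + 1) / 2 * Real.log ((1 + lam) / lam) - 1))
    (n : ℕ) (hn : 0 < n) (y : ℕ → ℝ) (hy0 : ∀ j < n, 0 < y j) (hy : ∀ j < n, y j ≤ lam / (1 + lam)) :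
    (n : ℝ) ^ c * ∑ j ∈ Finset.range n, (1 - y j) / √(y j) ≤
      (1 - ∏ j ∈ Finset.range n, y j) / √(∏ j ∈ Finset.range n, y j) := by
  set t := Real.log ((1 + lam) / lam) with ht
  have ht' : Real.log (1 + lam) - Real.log lam = t := by
    rw [ht, Real.log_div (by positivity) hlam.ne']
  rw [ht'] at hc
  obtain ⟨hca, hcb⟩ := lt_min_iff.1 hc
  have ht0 : 0 < t := Real.log_pos (by rw [lt_div_iff₀ hlam]; linarith)
  have hq : 0 < lam / (1 + lam) := by positivity
  have htq : t = -Real.log (lam / (1 + lam)) := by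
    rw [ht, ← Real.log_inv, inv_div]
  have hsc : Real.cosh (t / 2) = (2 * lam + 1) * Real.sinh (t / 2) := by
    have e1 : Real.exp (t / 2) * Real.exp (t / 2) = (1 + lam) / lam := by
      rw [← Real.exp_add, add_halves, Real.exp_log (by positivity)]
    have e2 : Real.exp (t / 2) * Real.exp (-(t / 2)) = 1 := by rw [← Real.exp_add]; simp
    have e3 : Real.exp (t / 2) * lam * Real.exp (t / 2) = 1 + lam := by
      calc _ = lam * (Real.exp (t / 2) * Real.exp (t / 2)) := by ring
        _ = _ := by rw [e1]; field_simp
    have hp := Real.exp_pos (t / 2)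
    rw [Real.cosh_eq, Real.sinh_eq]
    apply mul_left_cancel₀ hp.ne'
    linear_combination (1 + lam) * e2 - e3
  have hs0 : 0 < Real.sinh (t / 2) := Real.sinh_pos_iff.2 (by positivity)
  have hmain := hc_sinh_main (t / 2) c (by positivity)
    (by
      rw [hsc]
      rw [lt_div_iff₀ (by positivity)] at hca
      have : c * (2 * lam + 1) ≤ t / 2 := by linarith
      calc _ = c * (2 * lam + 1) * Real.sinh (t / 2) := by ring
        _ ≤ _ := by gcongr)
    (by
      rw [hsc]
      calc _ ≤ ((2 * lam + 1) / 2 * t) * Real.sinh (t / 2) := by gcongr; linarith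
        _ = _ := by ring) n hn (fun j => -(Real.log (y j)) / 2)
    (by
      intro j hj
      have := Real.log_le_log (hy0 j hj) (hy j hj)
      linarith)
  have hP : 0 < ∏ j ∈ Finset.range n, y j :=
    Finset.prod_pos (fun j hj => hy0 j (Finset.mem_range.1 hj))
  rw [hc_sinh_y _ hP, Real.log_prod (fun j hj => (hy0 j (Finset.mem_range.1 hj)).ne'),
    Finset.sum_congr rfl (fun j hj => hc_sinh_y (y j) (hy0 j (Finset.mem_range.1 hj))), ← Finset.mul_sum]
  rw [← Finset.sum_div, Finset.sum_neg_distrib] at hmain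
  linarith

/-- AM-GM step -/
lemma hc_amgm (D : ℕ) (hD : 1 ≤ D) (d : ℕ) (hd : d ≤ D) (P : Fin d → ℝ) (hP1 : ∀ i, P i ≤ 1) :
    (∏ i, (1 - P i)) * (D * ∑ i, P i - 1) * (D : ℝ) ^ D ≤ ((D : ℝ) - 1) ^ (D + 1) := by
  have hD1 : (1 : ℝ) ≤ D := by exact_mod_cast hD
  have hpr : 0 ≤ ∏ i, (1 - P i) := Finset.prod_nonneg (fun i _ => sub_nonneg.2 (hP1 i))
  rcases le_or_gt (D * ∑ i, P i - 1) 0 with h | h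
  · have h1 : (∏ i, (1 - P i)) * (D * ∑ i, P i - 1) * (D : ℝ) ^ D ≤ 0 :=
      mul_nonpos_of_nonpos_of_nonneg (mul_nonpos_of_nonneg_of_nonpos hpr h) (by positivity)
    exact h1.trans (pow_nonneg (by linarith) _)
  · let z : Fin d ⊕ (Fin (D - d) ⊕ Unit) → ℝ :=
      Sum.elim (fun i => D * (1 - P i)) (Sum.elim (fun _ => (D : ℝ)) (fun _ => D * ∑ i, P i - 1))
    have hz : ∀ i ∈ (Finset.univ : Finset (Fin d ⊕ (Fin (D - d) ⊕ Unit))), 0 ≤ z i := by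
      rintro (i | i | i) _
      · exact mul_nonneg (by linarith) (sub_nonneg.2 (hP1 i))
      · simp [z]
      · simpa [z] using h.le
    have hcast : ((D - d : ℕ) : ℝ) = D - d := by push_cast [hd]; ring
    have key := Real.geom_mean_le_arith_mean Finset.univ (fun _ => (1 : ℝ)) z
      (fun _ _ => zero_le_one) (by simp; positivity) hz
    have hsum : ∑ i, z i = (D + 1) * ((D : ℝ) - 1) := by
      simp only [z, Fintype.sum_sum_type, Sum.elim_inl, Sum.elim_inr, Finset.sum_const,
        Finset.card_univ, Fintype.card_fin, nsmul_eq_mul, hcast, ← Finset.mul_sum,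
        Finset.sum_sub_distrib, Fintype.card_unit]
      push_cast
      ring
    have hprod : ∏ i, z i = (∏ i, (1 - P i)) * (D * ∑ i, P i - 1) * (D : ℝ) ^ D := by
      have : (D : ℝ) ^ D = (D : ℝ) ^ d * (D : ℝ) ^ (D - d) := by
        rw [← pow_add]; congr 1; omega
      rw [this]
      simp only [z, Fintype.prod_sum_type, Sum.elim_inl, Sum.elim_inr, Finset.prod_const,
        Finset.card_univ, Fintype.card_fin, Finset.prod_mul_distrib, Fintype.card_unit]
      ring
    have hcard : ∑ i : Fin d ⊕ (Fin (D - d) ⊕ Unit), (1 : ℝ) = ((D + 1 : ℕ) : ℝ) := by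
      simp only [Finset.sum_const, Finset.card_univ, Fintype.card_sum, Fintype.card_fin,
        Fintype.card_unit, nsmul_eq_mul, mul_one]
      congr 1; omega
    simp only [Real.rpow_one, one_mul, hcard, hsum, hprod] at key
    have hnn : 0 ≤ (∏ i, (1 - P i)) * (D * ∑ i, P i - 1) * (D : ℝ) ^ D := by positivity
    have hD2 : (0:ℝ) < D + 1 := by positivity
    have e : ((D : ℝ) + 1) * (D - 1) / ((D + 1 : ℕ) : ℝ) = D - 1 := by
      push_cast; field_simp
    rw [e] at key
    have k2 := pow_le_pow_left₀ (Real.rpow_nonneg hnn _) key (D + 1)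
    rwa [Real.rpow_inv_natCast_pow hnn (by omega)] at k2

/-- final scalar estimate -/
lemma hc_final (D : ℕ) (hD : 1 ≤ D) (lam : ℝ) (hlam : 0 < lam) (d : ℕ) (hd : d ≤ D)
    (P : Fin d → ℝ) (hP0 : ∀ i, 0 ≤ P i) (hP1 : ∀ i, P i ≤ 1) (F : ℝ)
    (hF : F = lam * ∏ i, (1 - P i))
    (hcr : lam * ((D : ℝ) - 1) ^ (D + 1) < (D : ℝ) ^ D) :
    √(F / (1 + F)) * ∑ i, √(P i) ≤
      √((lam * ((D : ℝ) - 1) ^ (D + 1) / (D : ℝ) ^ D + lam) / (1 + lam)) := by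
  have hD1 : (1 : ℝ) ≤ D := by exact_mod_cast hD
  have hpr : 0 ≤ ∏ i, (1 - P i) := Finset.prod_nonneg (fun i _ => sub_nonneg.2 (hP1 i))
  have hpr1 : ∏ i, (1 - P i) ≤ 1 :=
    Finset.prod_le_one (fun i _ => sub_nonneg.2 (hP1 i)) (fun i _ => by linarith [hP0 i])
  have hF0 : 0 ≤ F := by rw [hF]; positivity
  have hFl : F ≤ lam := by rw [hF]; nlinarith
  have hDD : (0 : ℝ) < (D : ℝ) ^ D := by positivity
  set κ := lam * ((D : ℝ) - 1) ^ (D + 1) / (D : ℝ) ^ D with hκ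
  have hk : F * (D * ∑ i, P i - 1) ≤ κ := by
    rw [hκ, le_div_iff₀ hDD, hF]
    have := hc_amgm D hD d hd P hP1
    calc _ = lam * ((∏ i, (1 - P i)) * (D * ∑ i, P i - 1) * (D : ℝ) ^ D) := by ring
      _ ≤ _ := by gcongr
  apply Real.le_sqrt_of_sq_le
  have hcs : (∑ i, √(P i)) ^ 2 ≤ D * ∑ i, P i := by
    have h := sq_sum_le_card_mul_sum_sq (s := Finset.univ) (f := fun i => √(P i))
    have e : ∑ i, √(P i) ^ 2 = ∑ i, P i :=
      Finset.sum_congr rfl (fun i _ => Real.sq_sqrt (hP0 i))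
    rw [e, Finset.card_univ, Fintype.card_fin] at h
    have hs : 0 ≤ ∑ i, P i := Finset.sum_nonneg (fun i _ => hP0 i)
    have hdD : (d : ℝ) ≤ D := by exact_mod_cast hd
    exact h.trans (mul_le_mul_of_nonneg_right hdD hs)
  have hk1 : κ < 1 := by rwa [hκ, div_lt_one hDD]
  rw [mul_pow, Real.sq_sqrt (by positivity)]
  calc F / (1 + F) * (∑ i, √(P i)) ^ 2 ≤ F / (1 + F) * (D * ∑ i, P i) := by gcongr
    _ = (F * (D * ∑ i, P i - 1) + F) / (1 + F) := by ring
    _ ≤ (κ + F) / (1 + F) := by gcongr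
    _ ≤ (κ + lam) / (1 + lam) := by
      rw [div_le_div_iff₀ (by positivity) (by positivity)]
      nlinarith

lemma hc_pd (lam : ℝ) {d : ℕ} (w : Fin d → ℕ) (x : Fin d → ℕ → ℝ) (a : Fin d) (b : ℕ)
    (hb : b < w a) (hx : 0 ≤ x a b) :
    hardcorePD lam w x a b =
      -(lam * (∏ i ∈ Finset.univ.erase a, (1 - ∏ j ∈ Finset.range (w i), x i j / (1 + x i j))) *
        (∏ j ∈ (Finset.range (w a)).erase b, x a j / (1 + x a j)) * (1 / (1 + x a b) ^ 2)) := by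
  unfold hardcorePD
  set A := ∏ i ∈ Finset.univ.erase a, (1 - ∏ j ∈ Finset.range (w i), x i j / (1 + x i j)) with hA
  set R := ∏ j ∈ (Finset.range (w a)).erase b, x a j / (1 + x a j) with hR
  have hfun : (fun t => hardcoreF lam w (Function.update x a (Function.update (x a) b t))) =
      fun t => lam * ((1 - t / (1 + t) * R) * A) := by
    funext t
    unfold hardcoreF
    rw [← Finset.mul_prod_erase Finset.univ _ (Finset.mem_univ a),
      ← Finset.mul_prod_erase (Finset.range (w a)) _ (Finset.mem_range.2 hb)]
    congr 2
    · simp only [Function.update_self]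
      congr 2
      refine Finset.prod_congr rfl (fun j hj => ?_)
      rw [Function.update_of_ne (Finset.ne_of_mem_erase hj)]
    · refine Finset.prod_congr rfl (fun i hi => ?_)
      rw [Function.update_of_ne (Finset.ne_of_mem_erase hi)]
  rw [hfun]
  have h1 : HasDerivAt (fun t : ℝ => t / (1 + t)) (1 / (1 + x a b) ^ 2) (x a b) := by
    have := (hasDerivAt_id (x a b)).div ((hasDerivAt_id (x a b)).const_add 1)
      (by simp only [id]; positivity)
    have e : (1 * (1 + id (x a b)) - id (x a b) * 1) / (1 + id (x a b)) ^ 2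
        = 1 / (1 + x a b) ^ 2 := by simp
    rw [e] at this
    exact this
  have h2 := ((((h1.mul_const R).const_sub 1).mul_const A).const_mul lam)
  rw [h2.deriv]
  ring

/-- bound of the contribution of one edge -/
lemma hc_term (lam : ℝ) (hlam : 0 < lam) (c : ℝ)
    (hc : c < min ((Real.log (1 + lam) - Real.log lam) / (2 + 4 * lam))
        ((2 * lam + 1) / 2 * Real.log ((1 + lam) / lam) - 1))
    {d : ℕ} (w : Fin d → ℕ) (hw : ∀ i, 0 < w i) (x : Fin d → ℕ → ℝ)
    (hx : ∀ i j, j < w i → x i j ∈ Set.Icc (0 : ℝ) lam)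
    (hP1 : ∀ i, ∏ j ∈ Finset.range (w i), x i j / (1 + x i j) < 1) (a : Fin d) :
    (w a : ℝ) ^ c * ∑ b ∈ Finset.range (w a),
        √((x a b * (1 + x a b)) / (hardcoreF lam w x * (1 + hardcoreF lam w x))) *
          |hardcorePD lam w x a b| ≤
      √(hardcoreF lam w x / (1 + hardcoreF lam w x)) *
        √(∏ j ∈ Finset.range (w a), x a j / (1 + x a j)) := by
  set F := hardcoreF lam w x with hFdef
  set P := ∏ j ∈ Finset.range (w a), x a j / (1 + x a j) with hPdef
  have hPa : P < 1 := hP1 a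
  set A := ∏ i ∈ Finset.univ.erase a, (1 - ∏ j ∈ Finset.range (w i), x i j / (1 + x i j)) with hA
  have hA0 : 0 < A := Finset.prod_pos (fun i _ => sub_pos.2 (hP1 i))
  have hF : F = lam * ((1 - P) * A) := by
    rw [hFdef, hardcoreF, ← Finset.mul_prod_erase Finset.univ _ (Finset.mem_univ a)]
  have hF0 : 0 < F := by
    have : 0 < 1 - P := sub_pos.2 hPa
    rw [hF]; positivity
  by_cases hz : ∃ b < w a, x a b = 0
  · obtain ⟨b0, hb0, hxb0⟩ := hz
    have : ∑ b ∈ Finset.range (w a),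
        √((x a b * (1 + x a b)) / (F * (1 + F))) * |hardcorePD lam w x a b| = 0 := by
      refine Finset.sum_eq_zero (fun b hb => ?_)
      rw [Finset.mem_range] at hb
      by_cases hbb : b = b0
      · subst hbb; simp [hxb0]
      · rw [hc_pd lam w x a b hb (hx a b hb).1]
        have : ∏ j ∈ (Finset.range (w a)).erase b, x a j / (1 + x a j) = 0 :=
          Finset.prod_eq_zero (Finset.mem_erase.2 ⟨Ne.symm hbb, Finset.mem_range.2 hb0⟩)
            (by simp [hxb0])
        rw [this]; simp
    rw [this, mul_zero]
    positivity
  · push Not at hz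
    have hx0 : ∀ b < w a, 0 < x a b := fun b hb => lt_of_le_of_ne (hx a b hb).1 (hz b hb).symm
    have hP0 : 0 < P := Finset.prod_pos (fun j hj => by
      have := hx0 j (Finset.mem_range.1 hj); positivity)
    have hedge := hc_edge lam c hlam hc (w a) (hw a) (fun j => x a j / (1 + x a j))
      (fun j hj => by have := hx0 j hj; positivity)
      (fun j hj => by
        have h1 := hx0 j hj
        have h2 := (hx a j hj).2
        rw [div_le_div_iff₀ (by positivity) (by positivity)]
        nlinarith)
    have hterm : ∀ b ∈ Finset.range (w a),
        √((x a b * (1 + x a b)) / (F * (1 + F))) * |hardcorePD lam w x a b| =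
        √(F / (1 + F)) * (P / (1 - P)) *
          ((1 - x a b / (1 + x a b)) / √(x a b / (1 + x a b))) := by
      intro b hb
      have hb' := Finset.mem_range.1 hb
      have hxb := hx0 b hb'
      rw [hc_pd lam w x a b hb' hxb.le, abs_neg, ← hA]
      set R := ∏ j ∈ (Finset.range (w a)).erase b, x a j / (1 + x a j) with hR
      have hPR : P = x a b / (1 + x a b) * R := by
        rw [hPdef, hR, Finset.mul_prod_erase _ (fun j => x a j / (1 + x a j)) hb]
      have hR0 : 0 < R := Finset.prod_pos (fun j hj => by
        have := hx0 j (Finset.mem_range.1 (Finset.mem_of_mem_erase hj)); positivity)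
      rw [abs_of_nonneg (by positivity)]
      have hP1' : 0 < 1 - P := sub_pos.2 hPa
      have hlA : lam * A = F / (1 - P) := by rw [hF]; field_simp
      rw [hlA]
      have hR' : R = P * (1 + x a b) / x a b := by rw [hPR]; field_simp
      rw [hR', Real.sqrt_div (by positivity), Real.sqrt_div hF0.le, Real.sqrt_div hxb.le,
        Real.sqrt_mul hxb.le, Real.sqrt_mul hF0.le]
      have hone : 1 - x a b / (1 + x a b) = 1 / (1 + x a b) := by field_simp; ring
      rw [hone]
      have q1 : 0 < √(x a b) := Real.sqrt_pos.2 hxb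
      have q2 : 0 < √F := Real.sqrt_pos.2 hF0
      have q3 : 0 < √(1 + F) := Real.sqrt_pos.2 (by positivity)
      have q4 : 0 < √(1 + x a b) := Real.sqrt_pos.2 (by positivity)
      have e1 : √(x a b) ^ 2 = x a b := Real.sq_sqrt hxb.le
      have e2 : √F ^ 2 = F := Real.sq_sqrt hF0.le
      field_simp
      rw [e1, e2]
      try ring
    rw [Finset.sum_congr rfl hterm, ← Finset.mul_sum]
    have hP1' : 0 < 1 - P := sub_pos.2 hPa
    calc _ = √(F / (1 + F)) * (P / (1 - P)) * ((w a : ℝ) ^ c * ∑ b ∈ Finset.range (w a),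
          ((1 - x a b / (1 + x a b)) / √(x a b / (1 + x a b)))) := by ring
      _ ≤ √(F / (1 + F)) * (P / (1 - P)) * ((1 - P) / √P) := by gcongr
      _ = √(F / (1 + F)) * √P := by
        have q1 : 0 < √P := Real.sqrt_pos.2 hP0
        have e1 : √P ^ 2 = P := Real.sq_sqrt hP0.le
        rw [mul_assoc]
        congr 1
        field_simp
        rw [e1]

/-- Amortized decay-rate bound for the hardcore recursion: for Δ ≥ 2, λ in the
    uniqueness region λ(Δ−2)^Δ < (Δ−1)^{Δ−1}, d < Δ and a positive constant
    c < min{(log(1+λ)−log λ)/(2+4λ), ((2λ+1)/2)log((1+λ)/λ) − 1}, there is α < 1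
    depending only on λ and d (not on the wᵢ) with
    Σ_a w_a^c Σ_b (Φ(f)/Φ(x_{ab}))·|∂f/∂x_{ab}| ≤ α on [0,λ]^{Σwᵢ}, where
    Φ(x) = 1/√(x(1+x)), so Φ(f)/Φ(x_{ab}) = √(x_{ab}(1+x_{ab})/(f(1+f))). -/
theorem stmt_4 (Δ : ℕ) (hΔ : 2 ≤ Δ) (lam : ℝ) (hlam : 0 < lam)
    (hcrit : lam * ((Δ : ℝ) - 2) ^ Δ < ((Δ : ℝ) - 1) ^ (Δ - 1))
    (d : ℕ) (hd : d < Δ) (c : ℝ) (hc0 : 0 < c)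
    (hc : c < min ((Real.log (1 + lam) - Real.log lam) / (2 + 4 * lam))
        ((2 * lam + 1) / 2 * Real.log ((1 + lam) / lam) - 1)) :
    ∃ α : ℝ, α < 1 ∧
      ∀ w : Fin d → ℕ, (∀ i, 0 < w i) →
        ∀ x : Fin d → ℕ → ℝ, (∀ i j, j < w i → x i j ∈ Set.Icc (0 : ℝ) lam) →
          ∑ a : Fin d, (w a : ℝ) ^ c *
              ∑ b ∈ Finset.range (w a),
                Real.sqrt ((x a b * (1 + x a b)) /
                    (hardcoreF lam w x * (1 + hardcoreF lam w x))) *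
                  |hardcorePD lam w x a b| ≤ α := by
  obtain ⟨D, rfl⟩ : ∃ D, Δ = D + 1 := ⟨Δ - 1, by omega⟩
  have hD : 1 ≤ D := by omega
  have hcr : lam * ((D : ℝ) - 1) ^ (D + 1) < (D : ℝ) ^ D := by
    have e1 : (((D + 1 : ℕ) : ℝ) - 2) = D - 1 := by push_cast; ring
    have e2 : (((D + 1 : ℕ) : ℝ) - 1) = D := by push_cast; ring
    rw [e1, e2] at hcrit
    simpa using hcrit
  refine ⟨√((lam * ((D : ℝ) - 1) ^ (D + 1) / (D : ℝ) ^ D + lam) / (1 + lam)), ?_, ?_⟩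
  · have hDD : (0 : ℝ) < (D : ℝ) ^ D := by positivity
    have : lam * ((D : ℝ) - 1) ^ (D + 1) / (D : ℝ) ^ D < 1 := by rwa [div_lt_one hDD]
    rw [Real.sqrt_lt' one_pos, one_pow, div_lt_one (by positivity)]
    linarith
  · intro w hw x hx
    have hy0 : ∀ i, ∀ j ∈ Finset.range (w i), 0 ≤ x i j / (1 + x i j) := by
      intro i j hj
      have := (hx i j (Finset.mem_range.1 hj)).1
      positivity
    have hy1 : ∀ i, ∀ j ∈ Finset.range (w i), x i j / (1 + x i j) < 1 := by
      intro i j hj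
      have := (hx i j (Finset.mem_range.1 hj)).1
      rw [div_lt_one (by positivity)]
      linarith
    have hP0 : ∀ i, 0 ≤ ∏ j ∈ Finset.range (w i), x i j / (1 + x i j) :=
      fun i => Finset.prod_nonneg (hy0 i)
    have hP1 : ∀ i, ∏ j ∈ Finset.range (w i), x i j / (1 + x i j) < 1 := by
      intro i
      have h0 : 0 ∈ Finset.range (w i) := Finset.mem_range.2 (hw i)
      rw [← Finset.mul_prod_erase _ _ h0]
      refine lt_of_le_of_lt (mul_le_of_le_one_right (hy0 i 0 h0) ?_) (hy1 i 0 h0)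
      exact Finset.prod_le_one (fun j hj => hy0 i j (Finset.mem_of_mem_erase hj))
        (fun j hj => (hy1 i j (Finset.mem_of_mem_erase hj)).le)
    refine (Finset.sum_le_sum (fun a _ => hc_term lam hlam c hc w hw x hx hP1 a)).trans ?_
    rw [← Finset.mul_sum]
    exact hc_final D hD lam hlam d (by omega) _ hP0 (fun i => (hP1 i).le) _ rfl hcr
end

section
/- Let G = (V, 𝓔, (β, γ)) be a two-state spin instance with external field λ > 0 and edge labels β(e), γ(e) ∈ (0, 1] for all e, and let v ∈ V have degree d with incident hyperedges e₁, …, e_d, where e_i = {v} ∪ {v_{i1}, …, v_{i w_i}}. Let G' be obtained from G by replacing v with d copies v₁, …, v_d, each e_i becoming e_i − v + v_i (keeping its labels). For i ∈ [d], j ∈ [w_i] define G⁰_{ij} := (((G'|_{v₁=0,…,v_{i−1}=0})|_{v_{i+1}=1,…,v_d=1}) − e_i)|_{v_{i1}=0,…,v_{i,j−1}=0} and G¹_{ij} := (((G'|_{v₁=0,…,v_{i−1}=0})|_{v_{i+1}=1,…,v_d=1}) − e_i)|_{v_{i1}=1,…,v_{i,j−1}=1}. Set R_v = Pr_G[σ(v)=1]/Pr_G[σ(v)=0],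 R⁰_{ij} = Pr_{G⁰_{ij}}[σ(v_{ij})=1]/Pr_{G⁰_{ij}}[σ(v_{ij})=0] and R¹_{ij} = Pr_{G¹_{ij}}[σ(v_{ij})=1]/Pr_{G¹_{ij}}[σ(v_{ij})=0]. Then R⁰_{i1} = R¹_{i1} for every i, and R_v = λ · ∏_{i=1}^d [ 1 − (1 − γ(e_i)) · (R⁰_{i1}/(1+R⁰_{i1})) · ∏_{j=2}^{w_i} R¹_{ij}/(1+R¹_{ij}) ] / [ 1 − (1 − β(e_i)) · (1/(1+R⁰_{i1})) · ∏_{j=2}^{w_i} 1/(1+R⁰_{ij}) ]. -/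
/-- A two-state spin instance on a hypergraph: a finite vertex set and a list of
    labeled hyperedges `(e, β(e), γ(e))` (a list so that edges keep their identity
    under the pinning operations). -/
structure Spin where
  V : Finset ℕ
  E : List (Finset ℕ × ℝ × ℝ)

namespace Spin

/-- Weight contributed by the labeled edge `e` when `S` is the set of vertices
    with spin 1: γ(e) if all vertices of e have spin 1, β(e) if all have spin 0,
    and 1 otherwise.  (An edge whose vertex set has been emptied by pinnings
    contributes β(e)·γ(e): pinnings always leave at most one of the two labels
    different from 1, so this is the consistent convention.) -/
noncomputable def edgeW (S : Finset ℕ) (e : Finset ℕ × ℝ × ℝ) : ℝ :=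
  if e.1 = ∅ then e.2.1 * e.2.2
  else if e.1 ⊆ S then e.2.2
  else if ∀ x ∈ e.1, x ∉ S then e.2.1
  else 1

/-- The weight λ^{|S|}·∏_e w(e,S) of the configuration assigning 1 exactly on S. -/
noncomputable def confW (G : Spin) (lam : ℝ) (S : Finset ℕ) : ℝ :=
  lam ^ S.card * (G.E.map (edgeW S)).prod

/-- The partition function Z(G) = Σ_σ w(σ). -/
noncomputable def Z (G : Spin) (lam : ℝ) : ℝ :=
  ∑ S ∈ G.V.powerset, G.confW lam S

open scoped Classical in
/-- The Gibbs probability of the event `p` on configurations. -/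
noncomputable def prob (G : Spin) (lam : ℝ) (p : Finset ℕ → Prop) : ℝ :=
  (∑ S ∈ G.V.powerset, if p S then G.confW lam S else 0) / G.Z lam

/-- Pin vertex `u` to 0: remove `u`, and on every edge containing `u` replace the
    edge by `e − u` with γ(e−u) := 1 (keeping β). -/
def pin0 (G : Spin) (u : ℕ) : Spin :=
  ⟨G.V.erase u, G.E.map (fun e => if u ∈ e.1 then (e.1.erase u, e.2.1, 1) else e)⟩

/-- Pin vertex `u` to 1: remove `u`, and on every edge containing `u` replace the
    edge by `e − u` with β(e−u) := 1 (keeping γ). -/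
def pin1 (G : Spin) (u : ℕ) : Spin :=
  ⟨G.V.erase u, G.E.map (fun e => if u ∈ e.1 then (e.1.erase u, 1, e.2.2) else e)⟩

/-- Pin a list of vertices to 0, in order. -/
def pin0s (G : Spin) (us : List ℕ) : Spin := us.foldl pin0 G

/-- Pin a list of vertices to 1, in order. -/
def pin1s (G : Spin) (us : List ℕ) : Spin := us.foldl pin1 G

/-- Remove the hyperedge with vertex set `s` from the edge list. -/
def delE (G : Spin) (s : Finset ℕ) : Spin :=
  ⟨G.V, G.E.filter (fun e => e.1 ≠ s)⟩

end Spin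


namespace Spin

def pinE0 (e : Finset ℕ × ℝ × ℝ) (u : ℕ) : Finset ℕ × ℝ × ℝ :=
  if u ∈ e.1 then (e.1.erase u, e.2.1, 1) else e

def pinE1 (e : Finset ℕ × ℝ × ℝ) (u : ℕ) : Finset ℕ × ℝ × ℝ :=
  if u ∈ e.1 then (e.1.erase u, 1, e.2.2) else e

theorem edgeW_pinE0 (S : Finset ℕ) (e : Finset ℕ × ℝ × ℝ) (u : ℕ) (hu : u ∉ S) :
    edgeW S (pinE0 e u) = edgeW S e := by
  obtain ⟨s, b, g⟩ := e
  unfold pinE0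
  split_ifs with h
  · simp only at h
    have hne : s ≠ ∅ := Finset.ne_empty_of_mem h
    have h1 : ¬ s ⊆ S := fun hs => hu (hs h)
    simp only [edgeW, hne, h1, if_false]
    by_cases h2 : s.erase u = ∅
    · have : ∀ x ∈ s, x ∉ S := by
        intro x hx
        by_cases hxu : x = u
        · exact hxu ▸ hu
        · exact absurd (Finset.mem_erase.2 ⟨hxu, hx⟩) (by simp [h2])
      rw [if_pos h2, if_pos this, mul_one]
    · have h3 : (∀ x ∈ s.erase u, x ∉ S) ↔ (∀ x ∈ s, x ∉ S) := by
        constructor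
        · intro hh x hx
          by_cases hxu : x = u
          · exact hxu ▸ hu
          · exact hh x (Finset.mem_erase.2 ⟨hxu, hx⟩)
        · intro hh x hx
          exact hh x (Finset.mem_of_mem_erase hx)
      simp only [h2, if_false, h3]
      by_cases h4 : s.erase u ⊆ S
      · have h5 : ¬ (∀ x ∈ s, x ∉ S) := by
          obtain ⟨y, hy⟩ := Finset.nonempty_iff_ne_empty.2 h2
          exact fun hh => hh y (Finset.mem_of_mem_erase hy) (h4 hy)
        rw [if_pos h4, if_neg h5]
      · rw [if_neg h4]
  · rfl

theorem edgeW_pinE1 (S : Finset ℕ) (e : Finset ℕ × ℝ × ℝ) (u : ℕ) (hu : u ∉ S) :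
    edgeW S (pinE1 e u) = edgeW (insert u S) e := by
  obtain ⟨s, b, g⟩ := e
  unfold pinE1
  split_ifs with h
  · simp only at h
    have hne : s ≠ ∅ := Finset.ne_empty_of_mem h
    have h1 : ¬ ∀ x ∈ s, x ∉ insert u S := fun hs => hs u h (by simp)
    have h3 : s ⊆ insert u S ↔ s.erase u ⊆ S := Finset.subset_insert_iff
    simp only [edgeW, hne, h1, if_false, h3]
    by_cases h2 : s.erase u = ∅
    · simp [h2]
    · simp only [h2, if_false, ite_self]
  · simp only at h
    have h3 : s ⊆ insert u S ↔ s ⊆ S := by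
      rw [Finset.subset_insert_iff, Finset.erase_eq_of_notMem h]
    have h4 : (∀ x ∈ s, x ∉ insert u S) ↔ (∀ x ∈ s, x ∉ S) := by
      refine forall₂_congr fun x hx => ?_
      have : x ≠ u := fun hh => h (hh ▸ hx)
      simp [this]
    simp only [edgeW, h3, h4]

theorem confW_pin0 (G : Spin) (lam : ℝ) (u : ℕ) (S : Finset ℕ) (hu : u ∉ S) :
    (G.pin0 u).confW lam S = G.confW lam S := by
  unfold confW pin0
  simp only [List.map_map]
  congr 2
  refine List.map_congr_left fun e _ => ?_
  exact edgeW_pinE0 S e u hu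

theorem confW_pin1 (G : Spin) (lam : ℝ) (u : ℕ) (S : Finset ℕ) (hu : u ∉ S) :
    lam * (G.pin1 u).confW lam S = G.confW lam (insert u S) := by
  unfold confW pin1
  simp only [List.map_map, Finset.card_insert_of_notMem hu, pow_succ']
  rw [← mul_assoc]
  congr 2
  refine List.map_congr_left fun e _ => ?_
  exact edgeW_pinE1 S e u hu

/-- restricted partition function -/
noncomputable def ZS (G : Spin) (lam : ℝ) (A B : Finset ℕ) : ℝ :=
  ∑ S ∈ G.V.powerset, if A ⊆ S ∧ Disjoint B S then G.confW lam S else 0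

theorem sum_split (V : Finset ℕ) (u : ℕ) (hu : u ∈ V) (f : Finset ℕ → ℝ) :
    ∑ S ∈ V.powerset, f S =
      ∑ S ∈ (V.erase u).powerset, f S + ∑ S ∈ (V.erase u).powerset, f (insert u S) := by
  conv_lhs => rw [← Finset.insert_erase hu]
  rw [Finset.sum_powerset_insert (by simp)]

theorem notMem_of_erase {V S : Finset ℕ} {u : ℕ} (h : S ∈ (V.erase u).powerset) : u ∉ S :=
  fun hh => by simpa using Finset.mem_powerset.1 h hh

theorem ZS_pin0 (G : Spin) (lam : ℝ) (u : ℕ) (hu : u ∈ G.V) (B : Finset ℕ) :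
    (G.pin0 u).ZS lam ∅ B = G.ZS lam ∅ (insert u B) := by
  unfold ZS
  rw [sum_split G.V u hu]
  have : ∑ S ∈ (G.V.erase u).powerset, (if (∅ : Finset ℕ) ⊆ insert u S ∧
      Disjoint (insert u B) (insert u S) then G.confW lam (insert u S) else 0) = 0 := by
    refine Finset.sum_eq_zero fun S _ => ?_
    rw [if_neg]
    simp
  rw [this, add_zero]
  refine Finset.sum_congr rfl fun S hS => ?_
  have := notMem_of_erase hS
  simp [this, confW_pin0]

theorem ZS_pin1 (G : Spin) (lam : ℝ) (u : ℕ) (hu : u ∈ G.V) (A : Finset ℕ) (hA : u ∉ A) :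
    lam * (G.pin1 u).ZS lam A ∅ = G.ZS lam (insert u A) ∅ := by
  unfold ZS
  rw [sum_split G.V u hu]
  have : ∑ S ∈ (G.V.erase u).powerset, (if insert u A ⊆ S ∧
      Disjoint ∅ S then G.confW lam S else 0) = 0 := by
    refine Finset.sum_eq_zero fun S hS => ?_
    rw [if_neg]
    intro h
    exact notMem_of_erase hS (h.1 (by simp))
  rw [this, zero_add, Finset.mul_sum]
  refine Finset.sum_congr rfl fun S hS => ?_
  have h := notMem_of_erase hS
  have h3 : insert u A ⊆ insert u S ↔ A ⊆ S := by
    rw [Finset.insert_subset_insert_iff hA]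
  simp [h3, mul_ite, confW_pin1 G lam u S h]

theorem ZS_empty (G : Spin) (lam : ℝ) : G.ZS lam ∅ ∅ = G.Z lam := by
  simp [ZS, Z]

theorem ZS_pin0s (lam : ℝ) (us : List ℕ) : ∀ (G : Spin), us.Nodup → (∀ u ∈ us, u ∈ G.V) →
    (G.pin0s us).Z lam = G.ZS lam ∅ us.toFinset := by
  suffices h : ∀ (us : List ℕ) (G : Spin), us.Nodup → (∀ u ∈ us, u ∈ G.V) →
      (G.pin0s us).Z lam = G.ZS lam ∅ us.toFinset from h us
  intro us
  induction us with
  | nil => intro G _ _; simp [pin0s, ZS_empty]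
  | cons u us ih =>
    intro G hn hm
    rw [List.nodup_cons] at hn
    have := ih (G.pin0 u) hn.2 (fun x hx => by
      refine Finset.mem_erase.2 ⟨?_, hm x (by simp [hx])⟩
      rintro rfl; exact hn.1 hx)
    rw [ZS_pin0 _ _ _ (hm u (by simp))] at this
    rw [List.toFinset_cons, ← this]
    rfl

theorem ZS_pin1s (lam : ℝ) (us : List ℕ) : ∀ (G : Spin), us.Nodup → (∀ u ∈ us, u ∈ G.V) →
    lam ^ us.length * (G.pin1s us).Z lam = G.ZS lam us.toFinset ∅ := by
  induction us with
  | nil => intro G _ _; simp [pin1s, ZS_empty]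
  | cons u us ih =>
    intro G hn hm
    rw [List.nodup_cons] at hn
    have := ih (G.pin1 u) hn.2 (fun x hx => by
      refine Finset.mem_erase.2 ⟨?_, hm x (by simp [hx])⟩
      rintro rfl; exact hn.1 hx)
    rw [List.toFinset_cons, ← ZS_pin1 _ _ _ (hm u (by simp)) _ (by simpa using hn.1), ← this,
      List.length_cons, pow_succ', mul_assoc]
    rfl

def Pos (G : Spin) : Prop := ∀ e ∈ G.E, 0 < e.2.1 ∧ 0 < e.2.2

theorem Pos.pin0 {G : Spin} (h : G.Pos) (u : ℕ) : (G.pin0 u).Pos := by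
  intro e he
  simp only [Spin.pin0, List.mem_map] at he
  obtain ⟨e', he', rfl⟩ := he
  have := h e' he'
  split_ifs
  · exact ⟨this.1, one_pos⟩
  · exact this

theorem Pos.pin1 {G : Spin} (h : G.Pos) (u : ℕ) : (G.pin1 u).Pos := by
  intro e he
  simp only [Spin.pin1, List.mem_map] at he
  obtain ⟨e', he', rfl⟩ := he
  have := h e' he'
  split_ifs
  · exact ⟨one_pos, this.2⟩
  · exact this

theorem Pos.pin0s {G : Spin} (h : G.Pos) (us : List ℕ) : (G.pin0s us).Pos := by
  induction us generalizing G with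
  | nil => exact h
  | cons u us ih => exact ih (h.pin0 u)

theorem Pos.pin1s {G : Spin} (h : G.Pos) (us : List ℕ) : (G.pin1s us).Pos := by
  induction us generalizing G with
  | nil => exact h
  | cons u us ih => exact ih (h.pin1 u)

theorem edgeW_pos (S : Finset ℕ) (e : Finset ℕ × ℝ × ℝ) (h : 0 < e.2.1 ∧ 0 < e.2.2) :
    0 < edgeW S e := by
  unfold edgeW
  split_ifs
  · exact mul_pos h.1 h.2
  · exact h.2
  · exact h.1
  · exact one_pos

theorem confW_pos {G : Spin} (h : G.Pos) {lam : ℝ} (hl : 0 < lam) (S : Finset ℕ) :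
    0 < G.confW lam S := by
  unfold confW
  refine mul_pos (pow_pos hl _) (List.prod_pos ?_)
  intro a ha
  obtain ⟨e, he, rfl⟩ := List.mem_map.1 ha
  exact edgeW_pos S e (h e he)

theorem Z_pos {G : Spin} (h : G.Pos) {lam : ℝ} (hl : 0 < lam) : 0 < G.Z lam :=
  Finset.sum_pos (fun S _ => confW_pos h hl S) ⟨∅, by simp⟩

theorem ratio_eq {G : Spin} (h : G.Pos) {lam : ℝ} (hl : 0 < lam) (u : ℕ) (hu : u ∈ G.V) :
    G.prob lam (fun S => u ∈ S) / G.prob lam (fun S => u ∉ S)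
      = lam * (G.pin1 u).Z lam / (G.pin0 u).Z lam ∧
    G.Z lam = lam * (G.pin1 u).Z lam + (G.pin0 u).Z lam := by
  have e1 : lam * (G.pin1 u).Z lam = ∑ S ∈ (G.V.erase u).powerset, G.confW lam (insert u S) := by
    rw [Z, Finset.mul_sum]
    exact Finset.sum_congr rfl fun S hS => confW_pin1 G lam u S (notMem_of_erase hS)
  have e0 : (G.pin0 u).Z lam = ∑ S ∈ (G.V.erase u).powerset, G.confW lam S := by
    exact Finset.sum_congr rfl fun S hS => confW_pin0 G lam u S (notMem_of_erase hS)
  have hz := (Z_pos h hl).ne'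
  constructor
  · rw [prob, prob, div_div_div_cancel_right₀ hz, e0, e1, sum_split _ u hu, sum_split _ u hu]
    congr 1
    · rw [Finset.sum_eq_zero, zero_add]
      · simp
      · intro S hS; simp [notMem_of_erase hS]
    · rw [add_comm, Finset.sum_eq_zero, zero_add]
      · exact Finset.sum_congr rfl fun S hS => by simp [notMem_of_erase hS]
      · intro S hS; simp
  · rw [e0, e1, Z, sum_split _ u hu, add_comm]

theorem ratio_out {G : Spin} (h : G.Pos) {lam : ℝ} (hl : 0 < lam) (u : ℕ) (hu : u ∈ G.V) (R : ℝ)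
    (hR : R = G.prob lam (fun S => u ∈ S) / G.prob lam (fun S => u ∉ S)) :
    1 / (1 + R) = (G.pin0 u).Z lam / G.Z lam ∧
    R / (1 + R) = lam * (G.pin1 u).Z lam / G.Z lam := by
  obtain ⟨h1, h2⟩ := ratio_eq h hl u hu
  rw [hR, h1, h2]
  have p0 := Z_pos (h.pin0 u) hl
  have p1 := Z_pos (h.pin1 u) hl
  constructor
  · field_simp
    ring
  · field_simp
    ring

theorem pin0s_V (us : List ℕ) : ∀ G : Spin, (G.pin0s us).V = G.V \ us.toFinset := by
  induction us with
  | nil => intro G; simp [pin0s]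
  | cons u us ih =>
    intro G
    have := ih (G.pin0 u)
    rw [show G.pin0s (u :: us) = (G.pin0 u).pin0s us from rfl, this]
    ext x; simp [pin0]; tauto

theorem pin1s_V (us : List ℕ) : ∀ G : Spin, (G.pin1s us).V = G.V \ us.toFinset := by
  induction us with
  | nil => intro G; simp [pin1s]
  | cons u us ih =>
    intro G
    have := ih (G.pin1 u)
    rw [show G.pin1s (u :: us) = (G.pin1 u).pin1s us from rfl, this]
    ext x; simp [pin1]; tauto

theorem pin0s_E (us : List ℕ) : ∀ G : Spin, (G.pin0s us).E = G.E.map (fun e => us.foldl pinE0 e) := by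
  induction us with
  | nil => intro G; simp [pin0s]
  | cons u us ih =>
    intro G
    rw [show G.pin0s (u :: us) = (G.pin0 u).pin0s us from rfl, ih (G.pin0 u)]
    simp only [pin0, List.map_map]
    rfl

theorem pin1s_E (us : List ℕ) : ∀ G : Spin, (G.pin1s us).E = G.E.map (fun e => us.foldl pinE1 e) := by
  induction us with
  | nil => intro G; simp [pin1s]
  | cons u us ih =>
    intro G
    rw [show G.pin1s (u :: us) = (G.pin1 u).pin1s us from rfl, ih (G.pin1 u)]
    simp only [pin1, List.map_map]
    rfl

theorem foldl_pinE0 (us : List ℕ) (x : ℕ) : ∀ e : Finset ℕ × ℝ × ℝ, (∀ u ∈ us, u ∈ e.1 → u = x) →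
    us.foldl pinE0 e = if x ∈ us ∧ x ∈ e.1 then (e.1.erase x, e.2.1, 1) else e := by
  induction us with
  | nil => intro e _; simp
  | cons u us ih =>
    intro e h
    rw [List.foldl_cons, ih]
    · by_cases hu : u ∈ e.1
      · obtain rfl := h u (by simp) hu
        simp [pinE0, hu]
      · have : x ∈ e.1 → x ≠ u := fun hx hxu => hu (hxu ▸ hx)
        simp only [pinE0, hu, if_false, List.mem_cons]
        congr 1
        apply propext
        tauto
    · intro y hy hye
      refine h y (by simp [hy]) ?_
      unfold pinE0 at hye
      split_ifs at hye
      · exact Finset.mem_of_mem_erase hye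
      · exact hye

theorem foldl_pinE1 (us : List ℕ) (x : ℕ) : ∀ e : Finset ℕ × ℝ × ℝ, (∀ u ∈ us, u ∈ e.1 → u = x) →
    us.foldl pinE1 e = if x ∈ us ∧ x ∈ e.1 then (e.1.erase x, 1, e.2.2) else e := by
  induction us with
  | nil => intro e _; simp
  | cons u us ih =>
    intro e h
    rw [List.foldl_cons, ih]
    · by_cases hu : u ∈ e.1
      · obtain rfl := h u (by simp) hu
        simp [pinE1, hu]
      · have : x ∈ e.1 → x ≠ u := fun hx hxu => hu (hxu ▸ hx)
        simp only [pinE1, hu, if_false, List.mem_cons]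
        congr 1
        apply propext
        tauto
    · intro y hy hye
      refine h y (by simp [hy]) ?_
      unfold pinE1 at hye
      split_ifs at hye
      · exact Finset.mem_of_mem_erase hye
      · exact hye

theorem tele (f : ℕ → ℝ) (n : ℕ) (hf : ∀ j, f j ≠ 0) :
    ∏ j ∈ Finset.range n, f (j + 1) / f j = f n / f 0 := by
  induction n with
  | zero => simp [hf 0]
  | succ n ih =>
    rw [Finset.prod_range_succ, ih, div_mul_div_comm, mul_comm, mul_div_mul_right _ _ (hf n)]

theorem prod_out {H : Spin} (h : H.Pos) {lam : ℝ} (hl : 0 < lam) (f : ℕ → ℕ) (n : ℕ)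
    (hf : Set.InjOn f {j | j < n}) (hm : ∀ j < n, f j ∈ H.V) (R : ℕ → ℝ)
    (hR : ∀ j < n, R j = (H.pin0s ((List.range j).map f)).prob lam (fun S => f j ∈ S) /
      (H.pin0s ((List.range j).map f)).prob lam (fun S => f j ∉ S)) :
    ∏ j ∈ Finset.range n, 1 / (1 + R j) =
      H.ZS lam ∅ (Finset.image f (Finset.range n)) / H.Z lam := by
  have key : ∀ j < n, 1 / (1 + R j) = (H.pin0s ((List.range (j+1)).map f)).Z lam /
      (H.pin0s ((List.range j).map f)).Z lam := by
    intro j hj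
    rw [(ratio_out (h.pin0s _) hl (f j) _ (R j) (hR j hj)).1]
    · congr 2
      simp [List.range_succ, pin0s]
    · rw [pin0s_V]
      simp only [Finset.mem_sdiff, hm j hj, true_and, List.mem_toFinset, List.mem_map,
        List.mem_range, not_exists, not_and]
      intro k hk hkj
      have := hf (show k < n by omega) hj hkj
      omega
  rw [Finset.prod_congr rfl fun j hj => key j (Finset.mem_range.1 hj)]
  rw [tele (fun j => (H.pin0s ((List.range j).map f)).Z lam) _ fun j => (Z_pos (h.pin0s _) hl).ne']
  have h2 : ((List.range n).map f).toFinset = Finset.image f (Finset.range n) := by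
    ext; simp
  rw [ZS_pin0s, h2]
  · rfl
  · refine List.Nodup.map_on ?_ List.nodup_range
    intro x hx y hy hxy
    exact hf (by simpa using hx) (by simpa using hy) hxy
  · intro u hu
    simp only [List.mem_map, List.mem_range] at hu
    obtain ⟨j, hj, rfl⟩ := hu
    exact hm j hj

theorem prod_in {H : Spin} (h : H.Pos) {lam : ℝ} (hl : 0 < lam) (f : ℕ → ℕ) (n : ℕ)
    (hf : Set.InjOn f {j | j < n}) (hm : ∀ j < n, f j ∈ H.V) (R : ℕ → ℝ)
    (hR : ∀ j < n, R j = (H.pin1s ((List.range j).map f)).prob lam (fun S => f j ∈ S) /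
      (H.pin1s ((List.range j).map f)).prob lam (fun S => f j ∉ S)) :
    ∏ j ∈ Finset.range n, R j / (1 + R j) =
      H.ZS lam (Finset.image f (Finset.range n)) ∅ / H.Z lam := by
  have key : ∀ j < n, R j / (1 + R j) =
      (lam ^ (j+1) * (H.pin1s ((List.range (j+1)).map f)).Z lam) /
      (lam ^ j * (H.pin1s ((List.range j).map f)).Z lam) := by
    intro j hj
    rw [(ratio_out (h.pin1s _) hl (f j) _ (R j) (hR j hj)).2]
    · have : H.pin1s ((List.range (j+1)).map f) = (H.pin1s ((List.range j).map f)).pin1 (f j) := by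
        simp [List.range_succ, pin1s]
      rw [this, pow_succ, mul_assoc, mul_div_mul_left _ _ (pow_pos hl _).ne']
    · rw [pin1s_V]
      simp only [Finset.mem_sdiff, hm j hj, true_and, List.mem_toFinset, List.mem_map,
        List.mem_range, not_exists, not_and]
      intro k hk hkj
      have := hf (show k < n by omega) hj hkj
      omega
  rw [Finset.prod_congr rfl fun j hj => key j (Finset.mem_range.1 hj)]
  rw [tele (fun j => lam ^ j * (H.pin1s ((List.range j).map f)).Z lam)
    _ fun j => (mul_pos (pow_pos hl _) (Z_pos (h.pin1s _) hl)).ne']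
  have h2 : ((List.range n).map f).toFinset = Finset.image f (Finset.range n) := by
    ext; simp
  have h3 := ZS_pin1s lam ((List.range n).map f) H ?_ ?_
  · rw [h2, List.length_map, List.length_range] at h3
    rw [h3]
    simp [pin1s]
  · refine List.Nodup.map_on ?_ List.nodup_range
    intro x hx y hy hxy
    exact hf (by simpa using hx) (by simpa using hy) hxy
  · intro u hu
    simp only [List.mem_map, List.mem_range] at hu
    obtain ⟨j, hj, rfl⟩ := hu
    exact hm j hj

end Spin

namespace Spin

theorem edgeW_insert_of_notMem (S : Finset ℕ) (e : Finset ℕ × ℝ × ℝ) (u : ℕ) (h : u ∉ e.1) :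
    edgeW (insert u S) e = edgeW S e := by
  have h3 : e.1 ⊆ insert u S ↔ e.1 ⊆ S := by
    rw [Finset.subset_insert_iff, Finset.erase_eq_of_notMem h]
  have h4 : (∀ x ∈ e.1, x ∉ insert u S) ↔ (∀ x ∈ e.1, x ∉ S) := by
    refine forall₂_congr fun x hx => ?_
    have : x ≠ u := fun hh => h (hh ▸ hx)
    simp [this]
  simp only [edgeW, h3, h4]

theorem edgeW_a (S s : Finset ℕ) (hs : s.Nonempty) (g : ℝ) :
    edgeW S (s, 1, g) = if s ⊆ S then g else 1 := by
  simp [edgeW, hs.ne_empty]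

theorem edgeW_b (S s : Finset ℕ) (hs : s.Nonempty) (b : ℝ) :
    edgeW S (s, b, 1) = if Disjoint s S then b else 1 := by
  have h : (∀ x ∈ s, x ∉ S) ↔ Disjoint s S := Finset.disjoint_left.symm
  simp only [edgeW, hs.ne_empty, if_false, h]
  by_cases h1 : s ⊆ S
  · have : ¬ Disjoint s S := by
      intro hd
      obtain ⟨x, hx⟩ := hs
      exact Finset.disjoint_left.1 hd hx (h1 hx)
    simp [this]
  · simp [h1]

theorem mem_take {d : ℕ} (vc : Fin d → ℕ) (hinj : Function.Injective vc) (i : ℕ) (k : Fin d) :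
    vc k ∈ ((List.finRange d).map vc).take i ↔ (k : ℕ) < i := by
  rw [← List.map_take, List.mem_map_of_injective hinj, List.mem_take_iff_getElem]
  constructor
  · rintro ⟨j, hj, rfl⟩
    simp at hj ⊢
    omega
  · intro h
    exact ⟨k, by simp [h], by simp⟩

theorem mem_drop {d : ℕ} (vc : Fin d → ℕ) (hinj : Function.Injective vc) (i : ℕ) (k : Fin d) :
    vc k ∈ ((List.finRange d).map vc).drop i ↔ i ≤ (k : ℕ) := by
  rw [← List.map_drop, List.mem_map_of_injective hinj, List.mem_drop_iff_getElem]
  constructor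
  · rintro ⟨j, hj, rfl⟩
    simp
  · intro h
    refine ⟨k - i, ?_, ?_⟩
    · simp; omega
    · ext
      simp; omega

theorem prod_filter_map {α : Type*} (l : List α) (p : α → Bool) (f : α → ℝ) :
    ((l.filter p).map f).prod = (l.map (fun x => if p x then f x else 1)).prod := by
  induction l with
  | nil => simp
  | cons a l ih =>
    by_cases h : p a <;> simp [h, ih]

/-- The instance `K_i` with the edge `e_i` deleted. -/
def Hs {d : ℕ} (G' : Spin) (vc : Fin d → ℕ) (eset : Fin d → Finset ℕ) (i : Fin d) : Spin :=
  Spin.delE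
    (Spin.pin1s
      (Spin.pin0s G' (((List.finRange d).map vc).take (i : ℕ)))
      (((List.finRange d).map vc).drop ((i : ℕ) + 1)))
    (insert (vc i) (eset i))

theorem Hs_pos {d : ℕ} {G' : Spin} (h : G'.Pos) (vc : Fin d → ℕ) (eset : Fin d → Finset ℕ)
    (i : Fin d) : (Hs G' vc eset i).Pos := by
  intro e he
  exact (h.pin0s _).pin1s _ e (List.mem_of_mem_filter he)

theorem Hs_V {d : ℕ} (V : Finset ℕ) (E : List (Finset ℕ × ℝ × ℝ)) (vc : Fin d → ℕ)
    (hinj : Function.Injective vc)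
    (hV : ∀ i, vc i ∉ V) (eset : Fin d → Finset ℕ) (i : Fin d) :
    (Hs ⟨V ∪ Finset.image vc Finset.univ, E⟩ vc eset i).V = insert (vc i) V := by
  simp only [Hs, delE, pin1s_V, pin0s_V]
  ext x
  simp only [Finset.mem_sdiff, Finset.mem_union, Finset.mem_image, Finset.mem_univ, true_and,
    List.mem_toFinset, Finset.mem_insert]
  constructor
  · rintro ⟨⟨h | ⟨k, rfl⟩, h1⟩, h2⟩
    · exact Or.inr h
    · rw [mem_take vc hinj] at h1
      rw [mem_drop vc hinj] at h2
      left
      congr 1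
      ext
      omega
  · rintro (rfl | h)
    · rw [mem_take vc hinj, mem_drop vc hinj]
      exact ⟨⟨Or.inr ⟨i, rfl⟩, by omega⟩, by omega⟩
    · refine ⟨⟨Or.inl h, ?_⟩, ?_⟩
      · intro hh
        obtain ⟨k, -, rfl⟩ := List.mem_map.1 (List.mem_of_mem_take hh)
        exact hV k h
      · intro hh
        obtain ⟨k, -, rfl⟩ := List.mem_map.1 (List.mem_of_mem_drop hh)
        exact hV k h

theorem Hs_prod {d : ℕ} (V V₀ : Finset ℕ) (E₀ : List (Finset ℕ × ℝ × ℝ)) (vc : Fin d → ℕ)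
    (hinj : Function.Injective vc) (hV : ∀ i, vc i ∉ V₀) (eset : Fin d → Finset ℕ)
    (hE : ∀ e ∈ E₀, e.1 ⊆ V₀) (hes : ∀ i, eset i ⊆ V₀) (be ga : Fin d → ℝ)
    (i : Fin d) (S : Finset ℕ) :
    ((Hs ⟨V, E₀ ++ List.ofFn (fun i => (insert (vc i) (eset i), be i, ga i))⟩ vc eset i).E.map
      (edgeW S)).prod = (E₀.map (edgeW S)).prod *
      ∏ k, (if k = i then 1 else if k < i then edgeW S (eset k, be k, 1)
        else edgeW S (eset k, 1, ga k)) := by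
  have hm0 : ∀ j x, x ∈ ((List.finRange d).map vc).take j → ∃ k, x = vc k := by
    intro j x hx
    obtain ⟨k, -, rfl⟩ := List.mem_map.1 (List.mem_of_mem_take hx)
    exact ⟨k, rfl⟩
  have hm1 : ∀ j x, x ∈ ((List.finRange d).map vc).drop j → ∃ k, x = vc k := by
    intro j x hx
    obtain ⟨k, -, rfl⟩ := List.mem_map.1 (List.mem_of_mem_drop hx)
    exact ⟨k, rfl⟩
  have hvs : ∀ k l, vc k ∉ eset l := fun k l h => hV k (hes l h)
  simp only [Hs, delE, prod_filter_map, pin1s_E, pin0s_E, List.map_append, List.map_map,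
    List.prod_append, List.map_ofFn, List.prod_ofFn]
  congr 1
  · congr 1
    refine List.map_congr_left fun e he => ?_
    have hn : ∀ k, vc k ∉ e.1 := fun k h => hV k (hE e he h)
    have h1 : (((List.finRange d).map vc).take (i : ℕ)).foldl pinE0 e = e := by
      rw [foldl_pinE0 _ (vc i), if_neg]
      · exact fun h => hn i h.2
      · intro u hu hue
        obtain ⟨k, rfl⟩ := hm0 _ _ hu
        exact absurd hue (hn k)
    have h2 : (((List.finRange d).map vc).drop (i + 1 : ℕ)).foldl pinE1 e = e := by
      rw [foldl_pinE1 _ (vc i), if_neg]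
      · exact fun h => hn i h.2
      · intro u hu hue
        obtain ⟨k, rfl⟩ := hm1 _ _ hu
        exact absurd hue (hn k)
    have h3 : e.1 ≠ insert (vc i) (eset i) := by
      intro h
      exact hn i (by rw [h]; simp)
    simp [h1, h2, h3]
  · refine Finset.prod_congr rfl fun k _ => ?_
    have hk : ∀ u, (∃ l, u = vc l) → u ∈ insert (vc k) (eset k) → u = vc k := by
      rintro u ⟨l, rfl⟩ hu
      rcases Finset.mem_insert.1 hu with h | h
      · exact h
      · exact absurd h (hvs l k)
    simp only [Function.comp]
    have key := foldl_pinE0 (((List.finRange d).map vc).take (i : ℕ)) (vc k)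
      (insert (vc k) (eset k), be k, ga k) (fun u hu hh => hk u (hm0 _ _ hu) hh)
    have key2 := foldl_pinE1 (((List.finRange d).map vc).drop (i + 1 : ℕ)) (vc k)
      (insert (vc k) (eset k), be k, ga k) (fun u hu hh => hk u (hm1 _ _ hu) hh)
    simp only [mem_take vc hinj] at key
    simp only [mem_drop vc hinj] at key2
    have hne : ∀ l, eset l ≠ insert (vc i) (eset i) := fun l h => hvs i l (by rw [h]; simp)
    rcases lt_trichotomy k i with h | h | h
    · have h' : (k : ℕ) < i := h
      have hn : ∀ (b g : ℝ), (((List.finRange d).map vc).drop (i + 1 : ℕ)).foldl pinE1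
          (eset k, b, g) = (eset k, b, g) := by
        intro b g
        rw [foldl_pinE1 _ (vc i), if_neg]
        · exact fun h => hvs i k h.2
        · intro u hu hue
          obtain ⟨l, rfl⟩ := hm1 _ _ hu
          exact absurd hue (hvs l k)
      rw [if_pos ⟨h', by simp⟩] at key
      simp only [key, Finset.erase_insert (hvs k k), hn]
      simp [hne, h, h.ne]
    · subst h
      rw [if_neg (by simp)] at key
      rw [if_neg (by simp)] at key2
      simp [key, key2]
    · have h' : (i : ℕ) < k := h
      rw [if_neg (by simp; omega)] at key
      rw [if_pos ⟨by omega, by simp⟩] at key2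
      simp only [key, key2, Finset.erase_insert (hvs k k)]
      simp [hne, h.ne', not_lt.2 h.le]

end Spin

/-- Recursion for the marginal ratio in the two-state spin model on hypergraphs
    (Lemma for the hypergraph Ising/anti-ferromagnetic two-spin model).
    The instance `G` has vertex set `V₀`, non-incident edges `E₀` and incident
    edges `e i = insert v (eset i)` with labels `(be i, ga i)`, where
    `eset i = {vij i 0, …, vij i (w i − 1)}` (`vij i j` is the paper's v_{i,j+1}).
    `G'` splits `v` into fresh copies `vc i`.  `G0 i j` (the paper's G⁰_{i+1,j+1})
    pins the copies `vc k`, k < i, to 0 and the copies `vc k`, k > i, to 1,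
    removes the edge of `e i`, and pins `vij i 0, …, vij i (j−1)` to 0; `G1 i j`
    pins the latter to 1 instead.  Then R⁰ᵢ₁ = R¹ᵢ₁ and
    R_v = λ·∏ᵢ [1 − (1−γᵢ)(R⁰ᵢ₁/(1+R⁰ᵢ₁))∏_{j=2}^{wᵢ}R¹ᵢⱼ/(1+R¹ᵢⱼ)]
              /[1 − (1−βᵢ)(1/(1+R⁰ᵢ₁))∏_{j=2}^{wᵢ}1/(1+R⁰ᵢⱼ)]. -/
theorem stmt_14 (lam : ℝ) (hlam : 0 < lam)
    (V₀ : Finset ℕ) (E₀ : List (Finset ℕ × ℝ × ℝ))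
    (hE₀sub : ∀ e ∈ E₀, e.1 ⊆ V₀)
    (hE₀lab : ∀ e ∈ E₀, e.2.1 ∈ Set.Ioc (0 : ℝ) 1 ∧ e.2.2 ∈ Set.Ioc (0 : ℝ) 1)
    (v : ℕ) (hv : v ∈ V₀)
    (hE₀v : ∀ e ∈ E₀, v ∉ e.1)
    (d : ℕ) (w : Fin d → ℕ) (hw : ∀ i, 1 ≤ w i)
    (vij : Fin d → ℕ → ℕ)
    (hvmem : ∀ i j, j < w i → vij i j ∈ V₀)
    (hvne : ∀ i j, j < w i → vij i j ≠ v)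
    (hvinj : ∀ i, Set.InjOn (vij i) {j : ℕ | j < w i})
    (be ga : Fin d → ℝ)
    (hbe : ∀ i, be i ∈ Set.Ioc (0 : ℝ) 1) (hga : ∀ i, ga i ∈ Set.Ioc (0 : ℝ) 1)
    (eset : Fin d → Finset ℕ)
    (heset : ∀ i, eset i = Finset.image (vij i) (Finset.range (w i)))
    (G : Spin)
    (hG : G = ⟨V₀, E₀ ++ List.ofFn (fun i => (insert v (eset i), be i, ga i))⟩)
    (vc : Fin d → ℕ) (hvcinj : Function.Injective vc) (hvcfresh : ∀ i, vc i ∉ V₀)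
    (G' : Spin)
    (hG' : G' = ⟨(V₀.erase v) ∪ Finset.image vc Finset.univ,
        E₀ ++ List.ofFn (fun i => (insert (vc i) (eset i), be i, ga i))⟩)
    (G0 G1 : Fin d → ℕ → Spin)
    (hG0 : ∀ (i : Fin d), ∀ j < w i, G0 i j =
      Spin.pin0s
        (Spin.delE
          (Spin.pin1s
            (Spin.pin0s G' (((List.finRange d).map vc).take (i : ℕ)))
            (((List.finRange d).map vc).drop ((i : ℕ) + 1)))
          (insert (vc i) (eset i)))
        ((List.range j).map (vij i)))
    (hG1 : ∀ (i : Fin d), ∀ j < w i, G1 i j =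
      Spin.pin1s
        (Spin.delE
          (Spin.pin1s
            (Spin.pin0s G' (((List.finRange d).map vc).take (i : ℕ)))
            (((List.finRange d).map vc).drop ((i : ℕ) + 1)))
          (insert (vc i) (eset i)))
        ((List.range j).map (vij i)))
    (Rv : ℝ)
    (hRv : Rv = G.prob lam (fun S => v ∈ S) / G.prob lam (fun S => v ∉ S))
    (R0 R1 : Fin d → ℕ → ℝ)
    (hR0 : ∀ (i : Fin d), ∀ j < w i, R0 i j =
      (G0 i j).prob lam (fun S => vij i j ∈ S) / (G0 i j).prob lam (fun S => vij i j ∉ S))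
    (hR1 : ∀ (i : Fin d), ∀ j < w i, R1 i j =
      (G1 i j).prob lam (fun S => vij i j ∈ S) / (G1 i j).prob lam (fun S => vij i j ∉ S)) :
    (∀ i : Fin d, R0 i 0 = R1 i 0) ∧
    Rv = lam * ∏ i : Fin d,
      (1 - (1 - ga i) * (R0 i 0 / (1 + R0 i 0)) *
          ∏ j ∈ Finset.Ico 1 (w i), R1 i j / (1 + R1 i j)) /
        (1 - (1 - be i) * (1 / (1 + R0 i 0)) *
          ∏ j ∈ Finset.Ico 1 (w i), 1 / (1 + R0 i j)) := by
  classical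
  have hzero : ∀ i : Fin d, R0 i 0 = R1 i 0 := by
    intro i
    have h0 : 0 < w i := hw i
    rw [hR0 i 0 h0, hR1 i 0 h0, hG0 i 0 h0, hG1 i 0 h0]
    simp [Spin.pin0s, Spin.pin1s]
  refine ⟨hzero, ?_⟩
  have hes : ∀ i, eset i ⊆ V₀.erase v := by
    intro i x hx
    rw [heset i] at hx
    simp only [Finset.mem_image, Finset.mem_range] at hx
    obtain ⟨j, hj, rfl⟩ := hx
    exact Finset.mem_erase.2 ⟨hvne i j hj, hvmem i j hj⟩
  have hesV : ∀ i, eset i ⊆ V₀ := fun i => (hes i).trans (Finset.erase_subset _ _)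
  have hvs : ∀ i, v ∉ eset i := fun i h => by simpa using hes i h
  have hesne : ∀ i, (eset i).Nonempty := by
    intro i
    rw [heset i]
    simp only [Finset.image_nonempty, Finset.nonempty_range_iff]
    have := hw i
    omega
  -- weights
  set f0 : Finset ℕ → ℝ := fun S => lam ^ S.card * (E₀.map (Spin.edgeW S)).prod with hf0
  set T : ℕ → ℝ := fun n => ∑ S ∈ (V₀.erase v).powerset, f0 S *
    ∏ k : Fin d, (if (k : ℕ) < n then Spin.edgeW S (eset k, be k, 1)
      else Spin.edgeW S (eset k, 1, ga k)) with hT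
  have hf0pos : ∀ S, 0 < f0 S := by
    intro S
    refine mul_pos (pow_pos hlam _) (List.prod_pos ?_)
    intro a ha
    obtain ⟨e, he, rfl⟩ := List.mem_map.1 ha
    exact Spin.edgeW_pos S e ⟨(hE₀lab e he).1.1, (hE₀lab e he).2.1⟩
  have hTpos : ∀ n, 0 < T n := by
    intro n
    refine Finset.sum_pos (fun S _ => mul_pos (hf0pos S) (Finset.prod_pos fun k _ => ?_)) ⟨∅, by simp⟩
    split_ifs
    · exact Spin.edgeW_pos _ _ ⟨(hbe k).1, one_pos⟩
    · exact Spin.edgeW_pos _ _ ⟨one_pos, (hga k).1⟩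
  have hGpos : G.Pos := by
    intro e he
    rw [hG] at he
    simp only [List.mem_append, List.mem_ofFn] at he
    rcases he with he | ⟨k, rfl⟩
    · exact ⟨(hE₀lab e he).1.1, (hE₀lab e he).2.1⟩
    · exact ⟨(hbe k).1, (hga k).1⟩
  have hG'pos : G'.Pos := by
    intro e he
    rw [hG'] at he
    simp only [List.mem_append, List.mem_ofFn] at he
    rcases he with he | ⟨k, rfl⟩
    · exact ⟨(hE₀lab e he).1.1, (hE₀lab e he).2.1⟩
    · exact ⟨(hbe k).1, (hga k).1⟩
  -- the root
  have hroot : Rv = lam * (T 0 / T d) := by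
    rw [hRv, (Spin.ratio_eq hGpos hlam v (by rw [hG]; exact hv)).1, mul_div_assoc]
    congr 2
    · rw [hG]
      refine Finset.sum_congr rfl fun S _ => ?_
      simp only [Spin.confW, Spin.pin1, List.map_append, List.map_map, List.prod_append,
        List.map_ofFn, List.prod_ofFn, hf0, mul_assoc]
      congr 2
      · congr 1
        refine List.map_congr_left fun e he => ?_
        simp [hE₀v e he]
      · refine Finset.prod_congr rfl fun k _ => ?_
        simp [Finset.erase_insert (hvs k)]
    · rw [hG]
      refine Finset.sum_congr rfl fun S _ => ?_
      simp only [Spin.confW, Spin.pin0, List.map_append, List.map_map, List.prod_append,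
        List.map_ofFn, List.prod_ofFn, hf0, mul_assoc]
      congr 2
      · congr 1
        refine List.map_congr_left fun e he => ?_
        simp [hE₀v e he]
      · refine Finset.prod_congr rfl fun k _ => ?_
        simp [Finset.erase_insert (hvs k)]
  have hprod : ∏ i : Fin d, T i / T (i + 1) = T 0 / T d := by
    rw [Fin.prod_univ_eq_prod_range (fun i => T i / T (i + 1)) d]
    have := Spin.tele (fun n => (T n)⁻¹) d (fun n => (inv_pos.2 (hTpos n)).ne')
    simp only [inv_div_inv] at this
    exact this
  rw [hroot, ← hprod]
  congr 1
  refine Finset.prod_congr rfl fun i _ => ?_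
  -- the instance H_i
  set H := Spin.Hs G' vc eset i with hH
  have hHpos : H.Pos := Spin.Hs_pos hG'pos vc eset i
  have hvcV : ∀ k, vc k ∉ V₀.erase v := fun k h => hvcfresh k (Finset.mem_of_mem_erase h)
  have hHV : H.V = insert (vc i) (V₀.erase v) := by
    rw [hH, hG']
    exact Spin.Hs_V _ _ vc hvcinj hvcV eset i
  set h : Finset ℕ → ℝ := fun S => f0 S *
    ∏ k, (if k = i then 1 else if k < i then Spin.edgeW S (eset k, be k, 1)
        else Spin.edgeW S (eset k, 1, ga k)) with hh
  have hconf : ∀ S, H.confW lam S = h S := by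
    intro S
    rw [Spin.confW, hH, hG', Spin.Hs_prod _ V₀ E₀ vc hvcinj hvcfresh eset hE₀sub hesV be ga i S]
    simp only [hh, hf0, mul_assoc]
  have hins : ∀ S ∈ (V₀.erase v).powerset, h (insert (vc i) S) = lam * h S := by
    intro S hS
    have hnot : vc i ∉ S := fun hx => hvcV i (Finset.mem_powerset.1 hS hx)
    have hnot2 : ∀ k, vc i ∉ eset k := fun k hx => hvcV i (hes k hx)
    simp only [hh, hf0, Finset.card_insert_of_notMem hnot, pow_succ']
    have e1 : E₀.map (Spin.edgeW (insert (vc i) S)) = E₀.map (Spin.edgeW S) :=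
      List.map_congr_left fun e he =>
        Spin.edgeW_insert_of_notMem S e _ (fun hx => hvcfresh i (hE₀sub e he hx))
    have e2 : ∀ k b g, Spin.edgeW (insert (vc i) S) (eset k, b, g) = Spin.edgeW S (eset k, b, g) :=
      fun k b g => Spin.edgeW_insert_of_notMem S _ _ (hnot2 k)
    simp only [e1, e2]
    ring
  have hZS : ∀ A B : Finset ℕ, A ⊆ V₀ → B ⊆ V₀ → H.ZS lam A B = (1 + lam) *
      ∑ S ∈ (V₀.erase v).powerset, if A ⊆ S ∧ Disjoint B S then h S else 0 := by
    intro A B hA hB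
    rw [Spin.ZS, hHV, Finset.sum_powerset_insert (hvcV i), add_mul, one_mul, Finset.mul_sum]
    congr 1
    · exact Finset.sum_congr rfl fun S _ => by rw [hconf]
    · refine Finset.sum_congr rfl fun S hS => ?_
      have a1 : A ⊆ insert (vc i) S ↔ A ⊆ S := by
        rw [Finset.subset_insert_iff, Finset.erase_eq_of_notMem (fun hx => hvcfresh i (hA hx))]
      have a2 : Disjoint B (insert (vc i) S) ↔ Disjoint B S := by
        rw [Finset.disjoint_insert_right]
        exact and_iff_right (fun hx => hvcfresh i (hB hx))
      simp only [a1, a2, hconf, hins S hS, mul_ite, mul_zero]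
  set A0 : ℝ := ∑ S ∈ (V₀.erase v).powerset, h S with hA0
  have hZ : H.Z lam = (1 + lam) * A0 := by
    rw [← Spin.ZS_empty, hZS ∅ ∅ (by simp) (by simp)]
    simp [hA0]
  have hA0pos : 0 < A0 := by
    have := Spin.Z_pos hHpos hlam
    rw [hZ] at this
    exact pos_of_mul_pos_right this (by positivity)
  have hTi : T i = A0 - (1 - ga i) *
      ∑ S ∈ (V₀.erase v).powerset, if eset i ⊆ S ∧ Disjoint ∅ S then h S else 0 := by
    rw [hT, hA0, Finset.mul_sum, ← Finset.sum_sub_distrib]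
    refine Finset.sum_congr rfl fun S _ => ?_
    have e : ∏ k : Fin d, (if (k : ℕ) < i then Spin.edgeW S (eset k, be k, 1)
      else Spin.edgeW S (eset k, 1, ga k)) =
      (∏ k, (if k = i then 1 else if k < i then Spin.edgeW S (eset k, be k, 1)
        else Spin.edgeW S (eset k, 1, ga k))) * Spin.edgeW S (eset i, 1, ga i) := by
      have : Spin.edgeW S (eset i, 1, ga i) =
          ∏ k, (if k = i then Spin.edgeW S (eset k, 1, ga k) else 1) := by simp
      rw [this, ← Finset.prod_mul_distrib]
      refine Finset.prod_congr rfl fun k _ => ?_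
      by_cases hk : k = i
      · subst hk; simp
      · simp [hk]
    rw [e, ← mul_assoc, Spin.edgeW_a S _ (hesne i)]
    change h S * _ = _
    by_cases hs : eset i ⊆ S
    · simp [hs]; ring
    · simp [hs]
  have hTi1 : T (i + 1) = A0 - (1 - be i) *
      ∑ S ∈ (V₀.erase v).powerset, if ∅ ⊆ S ∧ Disjoint (eset i) S then h S else 0 := by
    rw [hT, hA0, Finset.mul_sum, ← Finset.sum_sub_distrib]
    refine Finset.sum_congr rfl fun S _ => ?_
    have e : ∏ k : Fin d, (if (k : ℕ) < i + 1 then Spin.edgeW S (eset k, be k, 1)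
      else Spin.edgeW S (eset k, 1, ga k)) =
      (∏ k, (if k = i then 1 else if k < i then Spin.edgeW S (eset k, be k, 1)
        else Spin.edgeW S (eset k, 1, ga k))) * Spin.edgeW S (eset i, be i, 1) := by
      have : Spin.edgeW S (eset i, be i, 1) =
          ∏ k, (if k = i then Spin.edgeW S (eset k, be k, 1) else 1) := by simp
      rw [this, ← Finset.prod_mul_distrib]
      refine Finset.prod_congr rfl fun k _ => ?_
      by_cases hk : k = i
      · subst hk; simp
      · have : (k : ℕ) < i + 1 ↔ k < i := by
          rw [Fin.lt_def]
          have : (k : ℕ) ≠ i := fun hx => hk (Fin.ext hx)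
          omega
        simp [hk, this]
    rw [e, ← mul_assoc, Spin.edgeW_b S _ (hesne i)]
    change h S * _ = _
    by_cases hs : Disjoint (eset i) S
    · simp [hs]; ring
    · simp [hs]
  have hmem : ∀ j < w i, vij i j ∈ H.V := by
    intro j hj
    rw [hHV]
    exact Finset.mem_insert_of_mem (Finset.mem_erase.2 ⟨hvne i j hj, hvmem i j hj⟩)
  have p0 := Spin.prod_out hHpos hlam (vij i) (w i) (hvinj i) hmem (R0 i) (by
    intro j hj
    rw [hR0 i j hj, hG0 i j hj]
    rfl)
  have p1 := Spin.prod_in hHpos hlam (vij i) (w i) (hvinj i) hmem (R1 i) (by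
    intro j hj
    rw [hR1 i j hj, hG1 i j hj]
    rfl)
  rw [← heset i, Finset.prod_range_eq_mul_Ico _ (hw i), hZ] at p0 p1
  rw [hZS _ _ (by simp) (hesV i), mul_div_mul_left _ _ (by positivity)] at p0
  rw [hZS _ _ (hesV i) (by simp), mul_div_mul_left _ _ (by positivity), ← hzero i] at p1
  rw [mul_assoc, mul_assoc, p0, p1, hTi, hTi1, ← mul_div_assoc, ← mul_div_assoc,
    one_sub_div hA0pos.ne', one_sub_div hA0pos.ne', div_div_div_cancel_right₀ hA0pos.ne']
end
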